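/- Let (M_p)_{p∈ℕ₀} be a sequence of positive real numbers satisfying condition (M.1) and M_0 = 1, and let K ⊂ ℝ^d be a compact set. Let φ₁, φ₂ : ℝ^d → ℂ be smooth functions with supports contained in K such that ‖φ₁‖_{K,(s_p)} < ∞ and ‖φ₂‖_{K,(s_p)} < ∞ for every (s_p) ∈ 𝔯. Then for every (r_p) ∈ 𝔯 with r_1 > 2 the inequality ‖φ₁·φ₂‖_{K,(r_p)} ≤ ‖φ₁‖_{K,(r_p)/2} · ‖φ₂‖_{K,(r_p)/2} holds, where (r_p)/2 denotes the sequence (r̄_p) with r̄_0 = 1 and r̄_p = r_p/2 for p ≥ 1 (which belongs to 𝔯). -/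

import Mathlib

open scoped ENNReal

noncomputable section

/-- The class 𝔯: positive sequences with `r 0 = 1`, monotonically increasing,
tending to infinity. -/
def IsRSeq (r : ℕ → ℝ) : Prop :=
  r 0 = 1 ∧ (∀ p, 0 < r p) ∧ Monotone r ∧ Filter.Tendsto r Filter.atTop Filter.atTop

/-- The product sequence `R p = r 0 * r 1 * ⋯ * r p` (so `R 0 = r 0 = 1`). -/
def prodSeq (r : ℕ → ℝ) (p : ℕ) : ℝ := ∏ i ∈ Finset.range (p + 1), r i

/-- The one-dimensional operator `D_m = (1/i) ∂/∂x_m` acting on functions on `ℝ^d`. -/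
def Dm {d : ℕ} (m : Fin d) (f : (Fin d → ℝ) → ℂ) : (Fin d → ℝ) → ℂ :=
  fun x => -Complex.I * fderiv ℝ f x (Pi.single m 1)

/-- The multi-index derivative `D^k = D_1^{k_1} ⋯ D_d^{k_d}`. -/
def Dmulti {d : ℕ} (k : Fin d → ℕ) (f : (Fin d → ℝ) → ℂ) : (Fin d → ℝ) → ℂ :=
  ((List.ofFn fun m : Fin d => (Dm m)^[k m]).foldr (· ∘ ·) id) f

/-- The seminorm `‖φ‖_{K,(r_p)} = sup_k sup_{x ∈ K} |D^k φ(x)| / (R_{|k|} M_{|k|})`,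
valued in `ℝ≥0∞`. -/
def MRNormK {d : ℕ} (M r : ℕ → ℝ) (K : Set (Fin d → ℝ)) (φ : (Fin d → ℝ) → ℂ) : ℝ≥0∞ :=
  ⨆ k : Fin d → ℕ, (⨆ x ∈ K, (‖Dmulti k φ x‖₊ : ℝ≥0∞)) /
    ENNReal.ofReal (prodSeq r (∑ m, k m) * M (∑ m, k m))

/-- The sequence `(r_p)/2`: equal to `1` at `p = 0` and to `r p / 2` for `p ≥ 1`. -/
def halfSeq (r : ℕ → ℝ) : ℕ → ℝ := fun p => if p = 0 then 1 else r p / 2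

/-- Iterated derivative along a list of directions. -/
def DL {d : ℕ} (L : List (Fin d)) (f : (Fin d → ℝ) → ℂ) : (Fin d → ℝ) → ℂ :=
  L.foldr Dm f

theorem DL_snoc {d : ℕ} (L : List (Fin d)) (m : Fin d) (f : (Fin d → ℝ) → ℂ) :
    DL (L ++ [m]) f = DL L (Dm m f) := by
  simp [DL, List.foldr_append]

theorem Dm_smooth {d : ℕ} (m : Fin d) {f : (Fin d → ℝ) → ℂ}
    (hf : ContDiff ℝ (⊤ : ℕ∞) f) : ContDiff ℝ (⊤ : ℕ∞) (Dm m f) := by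
  unfold Dm
  refine contDiff_const.mul ?_
  have h : ContDiff ℝ (⊤ : ℕ∞) (fderiv ℝ f) := hf.fderiv_right (by simp)
  exact h.clm_apply contDiff_const

theorem DL_smooth {d : ℕ} (L : List (Fin d)) {f : (Fin d → ℝ) → ℂ}
    (hf : ContDiff ℝ (⊤ : ℕ∞) f) : ContDiff ℝ (⊤ : ℕ∞) (DL L f) := by
  induction L with
  | nil => exact hf
  | cons m L ih => exact Dm_smooth m ih

theorem smooth_diff {d : ℕ} {f : (Fin d → ℝ) → ℂ}
    (hf : ContDiff ℝ (⊤ : ℕ∞) f) : Differentiable ℝ f :=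
  hf.differentiable (by simp)

theorem DL_add {d : ℕ} (L : List (Fin d)) {f g : (Fin d → ℝ) → ℂ}
    (hf : ContDiff ℝ (⊤ : ℕ∞) f) (hg : ContDiff ℝ (⊤ : ℕ∞) g) :
    DL L (fun x => f x + g x) = fun x => DL L f x + DL L g x := by
  induction L with
  | nil => rfl
  | cons m L ih =>
    change Dm m (DL L _) = fun x => Dm m (DL L f) x + Dm m (DL L g) x
    rw [ih]
    funext x
    simp only [Dm]
    rw [fderiv_fun_add (smooth_diff (DL_smooth L hf) x) (smooth_diff (DL_smooth L hg) x)]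
    simp [mul_add]

theorem Dm_mul {d : ℕ} (m : Fin d) {f g : (Fin d → ℝ) → ℂ}
    (hf : ContDiff ℝ (⊤ : ℕ∞) f) (hg : ContDiff ℝ (⊤ : ℕ∞) g) :
    Dm m (fun x => f x * g x) = fun x => Dm m f x * g x + f x * Dm m g x := by
  funext x
  simp only [Dm]
  rw [fderiv_fun_mul (smooth_diff hf x) (smooth_diff hg x)]
  simp only [ContinuousLinearMap.add_apply, ContinuousLinearMap.smul_apply, smul_eq_mul]
  ring

theorem DL_mul_bound {d : ℕ} (x : Fin d → ℝ) (C : ℝ) (L : List (Fin d)) :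
    ∀ (f g : (Fin d → ℝ) → ℂ), ContDiff ℝ (⊤ : ℕ∞) f → ContDiff ℝ (⊤ : ℕ∞) g →
    ∀ (A B : ℕ → ℝ), (∀ S : List (Fin d), S.Sublist L → ‖DL S f x‖ ≤ A S.length) →
    (∀ S : List (Fin d), S.Sublist L → ‖DL S g x‖ ≤ B S.length) →
    (∀ i j, i + j = L.length → A i * B j ≤ C) →
    ‖DL L (fun x => f x * g x) x‖ ≤ 2 ^ L.length * C := by
  induction L using List.reverseRecOn with
  | nil =>
    intro f g hf hg A B hA hB hC
    have h1 : ‖f x‖ ≤ A 0 := hA [] (List.Sublist.refl _)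
    have h2 : ‖g x‖ ≤ B 0 := hB [] (List.Sublist.refl _)
    have h3 := hC 0 0 rfl
    have : ‖f x * g x‖ ≤ C := by
      rw [norm_mul]
      exact (mul_le_mul h1 h2 (norm_nonneg _) ((norm_nonneg _).trans h1)).trans h3
    simpa [DL] using this
  | append_singleton L m ih =>
    intro f g hf hg A B hA hB hC
    rw [DL_snoc, Dm_mul m hf hg,
      DL_add L ((Dm_smooth m hf).mul hg) (hf.mul (Dm_smooth m hg))]
    have hsub : ∀ S : List (Fin d), S.Sublist L → S.Sublist (L ++ [m]) := fun S hS =>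
      hS.trans (List.sublist_append_left _ _)
    have hsub' : ∀ S : List (Fin d), S.Sublist L → (S ++ [m]).Sublist (L ++ [m]) := fun S hS =>
      hS.append (List.Sublist.refl _)
    have e1 := ih (Dm m f) g (Dm_smooth m hf) hg (fun i => A (i + 1)) B
      (fun S hS => by simpa [DL_snoc] using hA _ (hsub' S hS))
      (fun S hS => hB S (hsub S hS))
      (fun i j hij => hC (i + 1) j (by simp; omega))
    have e2 := ih f (Dm m g) hf (Dm_smooth m hg) A (fun i => B (i + 1))
      (fun S hS => hA S (hsub S hS))
      (fun S hS => by simpa [DL_snoc] using hB _ (hsub' S hS))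
      (fun i j hij => hC i (j + 1) (by simp; omega))
    refine (norm_add_le _ _).trans ?_
    have : (2 : ℝ) ^ (L ++ [m]).length * C = 2 ^ L.length * C + 2 ^ L.length * C := by
      simp [pow_succ]; ring
    rw [this]
    exact add_le_add e1 e2

/-- The sorted list of directions of a multi-index. -/
def mlist {d : ℕ} (k : Fin d → ℕ) : List (Fin d) :=
  (List.finRange d).flatMap fun m => List.replicate (k m) m

theorem Dmulti_eq {d : ℕ} (k : Fin d → ℕ) (f : (Fin d → ℝ) → ℂ) :
    Dmulti k f = DL (mlist k) f := by
  have hrep : ∀ (n : ℕ) (m : Fin d) (h : (Fin d → ℝ) → ℂ),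
      (List.replicate n m).foldr Dm h = (Dm m)^[n] h := by
    intro n m h
    induction n with
    | zero => rfl
    | succ n ih => rw [List.replicate_succ, List.foldr_cons, ih, Function.iterate_succ_apply']
  unfold Dmulti mlist
  rw [List.ofFn_eq_map]
  generalize List.finRange d = l
  induction l with
  | nil => rfl
  | cons m l ih =>
    simp only [List.map_cons, List.foldr_cons, Function.comp_apply, List.flatMap_cons]
    rw [ih]
    simp only [DL, List.foldr_append, hrep]

theorem mlist_count {d : ℕ} (k : Fin d → ℕ) (m : Fin d) : (mlist k).count m = k m := by
  unfold mlist
  rw [List.count_flatMap]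
  have : (List.count m ∘ fun m' => List.replicate (k m') m') = fun m' => if m' = m then k m else 0 := by
    funext m'
    simp only [Function.comp_apply, List.count_replicate]
    by_cases h : m' = m
    · simp [h]
    · simp [h]
  rw [this, ← List.ofFn_eq_map, List.sum_ofFn]
  simp

theorem mlist_length {d : ℕ} (k : Fin d → ℕ) : (mlist k).length = ∑ m, k m := by
  unfold mlist
  rw [List.length_flatMap]
  simp only [List.length_replicate]
  rw [← List.ofFn_eq_map, List.sum_ofFn]

theorem mlist_sorted {d : ℕ} (k : Fin d → ℕ) : (mlist k).Pairwise (· ≤ ·) := by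
  unfold mlist
  rw [List.pairwise_flatMap]
  refine ⟨fun m _ => ?_, ?_⟩
  · rw [List.pairwise_replicate]; right; exact le_refl _
  · refine (List.pairwise_lt_finRange d).imp ?_
    intro a b hab x hx y hy
    rw [List.eq_of_mem_replicate hx, List.eq_of_mem_replicate hy]
    exact hab.le

theorem mlist_of_sublist {d : ℕ} (k : Fin d → ℕ) (S : List (Fin d)) (hS : S.Sublist (mlist k)) :
    mlist (fun m => S.count m) = S := by
  refine List.Perm.eq_of_pairwise (le := (· ≤ ·)) ?_ (mlist_sorted _) ((mlist_sorted k).sublist hS) ?_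
  · intro a b _ _ h1 h2; exact le_antisymm h1 h2
  · rw [List.perm_iff_count]
    intro a
    rw [mlist_count]

theorem prodSeq_succ (r : ℕ → ℝ) (p : ℕ) : prodSeq r (p + 1) = prodSeq r p * r (p + 1) := by
  unfold prodSeq
  rw [Finset.prod_range_succ]

theorem prodSeq_pos {r : ℕ → ℝ} (hr : IsRSeq r) (p : ℕ) : 0 < prodSeq r p :=
  Finset.prod_pos fun i _ => hr.2.1 i

theorem prodSeq_mul_le {r : ℕ → ℝ} (hr : IsRSeq r) (a b : ℕ) :
    prodSeq r a * prodSeq r b ≤ prodSeq r (a + b) := by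
  induction b with
  | zero => simp [prodSeq, hr.1]
  | succ b ih =>
    rw [← add_assoc, prodSeq_succ, prodSeq_succ, ← mul_assoc]
    exact mul_le_mul ih (hr.2.2.1 (by omega)) (hr.2.1 _).le (prodSeq_pos hr _).le

theorem prodSeq_half {r : ℕ → ℝ} (hr : IsRSeq r) (p : ℕ) :
    2 ^ p * prodSeq (halfSeq r) p = prodSeq r p := by
  induction p with
  | zero => simp [prodSeq, halfSeq, hr.1]
  | succ p ih =>
    rw [prodSeq_succ, prodSeq_succ, ← ih]
    simp [halfSeq, pow_succ]
    ring

theorem halfSeq_isR {r : ℕ → ℝ} (hr : IsRSeq r) (h2 : 2 < r 1) : IsRSeq (halfSeq r) := by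
  obtain ⟨h0, hpos, hmono, ht⟩ := hr
  refine ⟨by simp [halfSeq], ?_, ?_, ?_⟩
  · intro p
    by_cases hp : p = 0
    · simp [halfSeq, hp]
    · simp only [halfSeq, hp, if_false]; have := hpos p; linarith
  · refine monotone_nat_of_le_succ fun p => ?_
    by_cases hp : p = 0
    · subst hp; simp [halfSeq]; linarith
    · simp only [halfSeq, hp, if_false, Nat.succ_ne_zero]
      have := hmono (Nat.le_succ p)
      simp only [Nat.succ_eq_add_one] at this
      linarith
  · have : Filter.Tendsto (fun p => r p / 2) Filter.atTop Filter.atTop :=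
      ht.atTop_div_const (by norm_num)
    refine this.congr' ?_
    filter_upwards [Filter.eventually_gt_atTop 0] with p hp
    simp [halfSeq, hp.ne']

theorem M_mul_le (M : ℕ → ℝ) (hMpos : ∀ p, 0 < M p)
    (hM1 : ∀ p : ℕ, 1 ≤ p → M p ^ 2 ≤ M (p - 1) * M (p + 1)) (hM0 : M 0 = 1) (a b : ℕ) :
    M a * M b ≤ M (a + b) := by
  have hmono : Monotone fun p => M (p + 1) / M p := by
    refine monotone_nat_of_le_succ fun p => ?_
    rw [div_le_div_iff₀ (hMpos _) (hMpos _)]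
    have := hM1 (p + 1) (by omega)
    simp only [Nat.add_sub_cancel] at this
    nlinarith
  induction b with
  | zero => simp [hM0]
  | succ b ih =>
    have h := hmono (show b ≤ a + b by omega)
    simp only at h
    rw [← add_assoc]
    calc M a * M (b + 1) = (M a * M b) * (M (b + 1) / M b) := by
          have := (hMpos b).ne'
          field_simp
      _ ≤ M (a + b) * (M (a + b + 1) / M (a + b)) :=
          mul_le_mul ih h (div_pos (hMpos _) (hMpos _)).le (hMpos _).le
      _ = M (a + b + 1) := by
          have := (hMpos (a + b)).ne'
          field_simp

theorem le_MRNormK {d : ℕ} {M r : ℕ → ℝ} {K : Set (Fin d → ℝ)} {φ : (Fin d → ℝ) → ℂ}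
    (hM : ∀ p, 0 < M p) (hr : IsRSeq r) (hfin : MRNormK M r K φ < ⊤) {x : Fin d → ℝ}
    (hx : x ∈ K) (k : Fin d → ℕ) :
    ‖Dmulti k φ x‖ ≤ (MRNormK M r K φ).toReal * (prodSeq r (∑ m, k m) * M (∑ m, k m)) := by
  have hc : 0 < prodSeq r (∑ m, k m) * M (∑ m, k m) := mul_pos (prodSeq_pos hr _) (hM _)
  have h1 : (⨆ x ∈ K, (‖Dmulti k φ x‖₊ : ℝ≥0∞)) /
      ENNReal.ofReal (prodSeq r (∑ m, k m) * M (∑ m, k m)) ≤ MRNormK M r K φ :=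
    le_iSup (fun k : Fin d → ℕ => (⨆ x ∈ K, (‖Dmulti k φ x‖₊ : ℝ≥0∞)) /
      ENNReal.ofReal (prodSeq r (∑ m, k m) * M (∑ m, k m))) k
  rw [ENNReal.div_le_iff (by simpa using hc) ENNReal.ofReal_ne_top] at h1
  have h2 := (le_iSup₂ (f := fun x (_ : x ∈ K) => (‖Dmulti k φ x‖₊ : ℝ≥0∞)) x hx).trans h1
  have h3 := ENNReal.toReal_mono (ENNReal.mul_ne_top hfin.ne ENNReal.ofReal_ne_top) h2
  rw [ENNReal.toReal_mul, ENNReal.toReal_ofReal hc.le] at h3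
  simpa using h3

/-- If `φ₁, φ₂` are smooth functions supported in a compact set `K`, with
`‖φ₁‖_{K,(s_p)} < ∞` and `‖φ₂‖_{K,(s_p)} < ∞` for every `(s_p) ∈ 𝔯`, then for
every `(r_p) ∈ 𝔯` with `r 1 > 2` one has `(r_p)/2 ∈ 𝔯` and
`‖φ₁ · φ₂‖_{K,(r_p)} ≤ ‖φ₁‖_{K,(r_p)/2} · ‖φ₂‖_{K,(r_p)/2}`. -/
theorem stmt10 (d : ℕ) (M : ℕ → ℝ) (hMpos : ∀ p, 0 < M p)
    (hM1 : ∀ p : ℕ, 1 ≤ p → M p ^ 2 ≤ M (p - 1) * M (p + 1)) (hM0 : M 0 = 1)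
    (K : Set (Fin d → ℝ)) (hK : IsCompact K)
    (φ₁ φ₂ : (Fin d → ℝ) → ℂ)
    (hφ₁ : ContDiff ℝ (⊤ : ℕ∞) φ₁) (hφ₂ : ContDiff ℝ (⊤ : ℕ∞) φ₂)
    (hsupp₁ : tsupport φ₁ ⊆ K) (hsupp₂ : tsupport φ₂ ⊆ K)
    (hfin₁ : ∀ s : ℕ → ℝ, IsRSeq s → MRNormK M s K φ₁ < ⊤)
    (hfin₂ : ∀ s : ℕ → ℝ, IsRSeq s → MRNormK M s K φ₂ < ⊤) :
    ∀ r : ℕ → ℝ, IsRSeq r → 2 < r 1 →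
      IsRSeq (halfSeq r) ∧
        MRNormK M r K (fun x => φ₁ x * φ₂ x) ≤
          MRNormK M (halfSeq r) K φ₁ * MRNormK M (halfSeq r) K φ₂ := by
  intro r hr h2
  have hh := halfSeq_isR hr h2
  refine ⟨hh, ?_⟩
  have hf1 := hfin₁ _ hh
  have hf2 := hfin₂ _ hh
  have hb1 := fun {x : Fin d → ℝ} (hx : x ∈ K) k => le_MRNormK hMpos hh hf1 hx k
  have hb2 := fun {x : Fin d → ℝ} (hx : x ∈ K) k => le_MRNormK hMpos hh hf2 hx k
  rw [← ENNReal.ofReal_toReal hf1.ne, ← ENNReal.ofReal_toReal hf2.ne]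
  have hn1 : 0 ≤ (MRNormK M (halfSeq r) K φ₁).toReal := ENNReal.toReal_nonneg
  have hn2 : 0 ≤ (MRNormK M (halfSeq r) K φ₂).toReal := ENNReal.toReal_nonneg
  generalize (MRNormK M (halfSeq r) K φ₁).toReal = N1 at *
  generalize (MRNormK M (halfSeq r) K φ₂).toReal = N2 at *
  refine iSup_le fun k => ?_
  have hc : 0 < prodSeq r (∑ m, k m) * M (∑ m, k m) := mul_pos (prodSeq_pos hr _) (hMpos _)
  rw [ENNReal.div_le_iff (by simpa using hc) ENNReal.ofReal_ne_top,
    ← ENNReal.ofReal_mul hn1, ← ENNReal.ofReal_mul (mul_nonneg hn1 hn2)]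
  refine iSup₂_le fun x hx => ?_
  rw [← enorm_eq_nnnorm, ← ofReal_norm_eq_enorm]
  refine ENNReal.ofReal_le_ofReal ?_
  have key : ∀ (N : ℝ) (φ : (Fin d → ℝ) → ℂ),
      (∀ k : Fin d → ℕ, ‖Dmulti k φ x‖ ≤
        N * (prodSeq (halfSeq r) (∑ m, k m) * M (∑ m, k m))) →
      ∀ S : List (Fin d), S.Sublist (mlist k) →
        ‖DL S φ x‖ ≤ N * (prodSeq (halfSeq r) S.length * M S.length) := by
    intro N φ h S hS
    have e := mlist_of_sublist k S hS
    have h' := h (fun m => S.count m)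
    rw [Dmulti_eq, ← mlist_length, e] at h'
    exact h'
  have main := DL_mul_bound x
    (N1 * N2 * (prodSeq (halfSeq r) (mlist k).length * M (mlist k).length)) (mlist k) φ₁ φ₂ hφ₁ hφ₂
    (fun i => N1 * (prodSeq (halfSeq r) i * M i)) (fun i => N2 * (prodSeq (halfSeq r) i * M i))
    (key N1 φ₁ (hb1 hx)) (key N2 φ₂ (hb2 hx)) ?_
  · rw [Dmulti_eq, ← mlist_length, ← prodSeq_half hr]
    refine main.trans (le_of_eq ?_)
    ring
  · intro i j hij
    rw [← hij]
    calc N1 * (prodSeq (halfSeq r) i * M i) * (N2 * (prodSeq (halfSeq r) j * M j))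
        = N1 * N2 * ((prodSeq (halfSeq r) i * prodSeq (halfSeq r) j) * (M i * M j)) := by ring
      _ ≤ N1 * N2 * (prodSeq (halfSeq r) (i + j) * M (i + j)) := by
          refine mul_le_mul_of_nonneg_left ?_ (mul_nonneg hn1 hn2)
          exact mul_le_mul (prodSeq_mul_le hh i j) (M_mul_le M hMpos hM1 hM0 i j)
            (mul_pos (hMpos _) (hMpos _)).le (prodSeq_pos hh _).le
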